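/- arXiv:1309.2860 — 10 statements merged into one kernel-verified Lean document; each statement's English description precedes it below -/
import Mathlib

section
/- For every natural number m, if q^{m+1} > v(m+1) then q^{m} > v(m). (Equivalently: in the Bruss–Weber problem with unequal probabilities, if with m+1 observations remaining it is strictly optimal to stop on an observation equal to 1, then it is also strictly optimal to do so with m observations remaining; hence the problem is monotone with respect to stopping on a 1.) -/
/-- Bruss–Weber problem with unequal probabilities `p ≥ p' > 0`, `p + p' < 1`.
`v m` is the optimal success probability with `m` observations remaining,
defined by `v 0 = 0` and
`v (m+1) = p·max(v m, q^m) + p'·max(v m, q'^m) + q̃·v m`,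
where `q = 1 - p`, `q' = 1 - p'`, `q̃ = 1 - p - p'`.
Monotonicity with respect to stopping on a `1`:
if `q^(m+1) > v (m+1)` then `q^m > v m`. -/
theorem bruss_weber_monotone_one
    (p p' : ℝ) (hp' : 0 < p') (hpp' : p' ≤ p) (hsum : p + p' < 1)
    (v : ℕ → ℝ) (hv0 : v 0 = 0)
    (hv : ∀ m : ℕ, v (m + 1) =
      p * max (v m) ((1 - p) ^ m) + p' * max (v m) ((1 - p') ^ m)
        + (1 - p - p') * v m) :
    ∀ m : ℕ, (1 - p) ^ (m + 1) > v (m + 1) → (1 - p) ^ m > v m := by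
  intro m hm
  have h₁ : p * v m ≤ p * max (v m) ((1 - p) ^ m) :=
    mul_le_mul_of_nonneg_left (le_max_left _ _) (by linarith)
  have h₂ : p' * v m ≤ p' * max (v m) ((1 - p') ^ m) :=
    mul_le_mul_of_nonneg_left (le_max_left _ _) hp'.le
  have h₃ : (1 - p) ^ (m + 1) ≤ (1 - p) ^ m :=
    pow_le_pow_of_le_one (by linarith) (by linarith) m.le_succ
  have h₄ : v m ≤ v (m + 1) := by linarith [hv m]
  exact h₄.trans_lt (hm.trans_le h₃)
end

section
/- For every natural number m, if (q')^{m+1} > v(m+1) then (q')^{m} > v(m). (Equivalently: if with m+1 observations remaining it is strictly optimal to stop on an observation equal to −1, then it is also strictly optimal to do so with m observations remaining; hence the problem is monotone with respect to stopping on a −1.) -/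
/-- Bruss–Weber problem with unequal probabilities `p ≥ p' > 0`, `p + p' < 1`.
`v m` is the optimal success probability with `m` observations remaining.
Monotonicity with respect to stopping on a `-1`:
if `(q')^(m+1) > v (m+1)` then `(q')^m > v m`, where `q' = 1 - p'`. -/
theorem bruss_weber_monotone_minus_one
    (p p' : ℝ) (hp' : 0 < p') (hpp' : p' ≤ p) (hsum : p + p' < 1)
    (v : ℕ → ℝ) (hv0 : v 0 = 0)
    (hv : ∀ m : ℕ, v (m + 1) =
      p * max (v m) ((1 - p) ^ m) + p' * max (v m) ((1 - p') ^ m)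
        + (1 - p - p') * v m) :
    ∀ m : ℕ, (1 - p') ^ (m + 1) > v (m + 1) → (1 - p') ^ m > v m := by
  intro m h
  by_contra! hle
  have hmono : v m ≤ v (m + 1) := by
    rw [hv m]
    have h₁ := mul_le_mul_of_nonneg_left (le_max_left (v m) ((1 - p) ^ m)) (hp'.le.trans hpp')
    have h₂ := mul_le_mul_of_nonneg_left (le_max_left (v m) ((1 - p') ^ m)) hp'.le
    linarith
  have hpow : (1 - p') ^ (m + 1) ≤ (1 - p') ^ m :=
    pow_le_pow_of_le_one (by linarith) (by linarith) m.le_succ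
  linarith
end

section
/- For every j with 1 ≤ j ≤ n, the diagonal values of the success-probability recursion satisfy the closed form w(j,j) = (p/p')·(q^{n−j+1} − q̃^{n−j+1}) + (p'/p)·((q')^{n−j+1} − q̃^{n−j+1}). -/
/-- Closed form of the diagonal values `w j j` of the success-probability
recursion for the Bruss–Weber problem with `n` observations, probability `p`
of a `1` and `p'` of a `-1` (`q = 1 - p`, `q' = 1 - p'`, `q̃ = 1 - p - p'`):
`w j j = (p/p')·(q^(n-j+1) − q̃^(n-j+1)) + (p'/p)·((q')^(n-j+1) − q̃^(n-j+1))`. -/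
theorem bruss_weber_w_diagonal_closed_form
    (n : ℕ) (hn : 1 ≤ n) (p p' : ℝ) (hp : 0 < p) (hp' : 0 < p')
    (hsum : p + p' < 1) (w : ℕ → ℕ → ℝ)
    (hnn : w n n = p + p')
    (hdiag : ∀ j, 1 ≤ j → j < n →
      w j j = p' * (1 - p') ^ (n - j) + p * (1 - p) ^ (n - j)
        + (1 - p - p') * w (j + 1) (j + 1))
    (hoff : ∀ j k, 1 ≤ k → k < j → j ≤ n →
      w j k = p' * (1 - p') ^ (n - k) + (1 - p') * w j (k + 1)) :
    ∀ j, 1 ≤ j → j ≤ n →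
      w j j = (p / p') * ((1 - p) ^ (n - j + 1) - (1 - p - p') ^ (n - j + 1))
        + (p' / p) * ((1 - p') ^ (n - j + 1) - (1 - p - p') ^ (n - j + 1)) := by
  have hp0 : p ≠ 0 := hp.ne'
  have hp0' : p' ≠ 0 := hp'.ne'
  intro j hj hjn
  induction hjn using Nat.decreasingInduction with
  | self =>
    rw [hnn]
    simp only [Nat.sub_self, zero_add, pow_one]
    field_simp
    ring
  | of_succ j hlt ih =>
    rw [hdiag j hj hlt, ih (by omega)]
    obtain ⟨m, rfl⟩ := Nat.exists_eq_add_of_lt hlt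
    rw [show j + m + 1 - j = m + 1 by omega, show j + m + 1 - (j + 1) = m by omega]
    field_simp
    ring
end

section
/- For all j, k with 1 ≤ k ≤ j ≤ n, the success-probability recursion has the closed form w(j,k) = (j−k)·p'·(q')^{n−k} + (q')^{j−k}·[ (p/p')·(q^{n−j+1} − q̃^{n−j+1}) + (p'/p)·((q')^{n−j+1} − q̃^{n−j+1}) ]. -/
/-- Closed form of the values `w j k` (for `1 ≤ k ≤ j ≤ n`) of the
success-probability recursion for the Bruss–Weber problem with `n`
observations, probability `p` of a `1` and `p'` of a `-1`
(`q = 1 - p`, `q' = 1 - p'`, `q̃ = 1 - p - p'`):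
`w j k = (j-k)·p'·(q')^(n-k) + (q')^(j-k)·[(p/p')·(q^(n-j+1) − q̃^(n-j+1))
  + (p'/p)·((q')^(n-j+1) − q̃^(n-j+1))]`. -/
theorem bruss_weber_w_closed_form
    (n : ℕ) (hn : 1 ≤ n) (p p' : ℝ) (hp : 0 < p) (hp' : 0 < p')
    (hsum : p + p' < 1) (w : ℕ → ℕ → ℝ)
    (hnn : w n n = p + p')
    (hdiag : ∀ j, 1 ≤ j → j < n →
      w j j = p' * (1 - p') ^ (n - j) + p * (1 - p) ^ (n - j)
        + (1 - p - p') * w (j + 1) (j + 1))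
    (hoff : ∀ j k, 1 ≤ k → k < j → j ≤ n →
      w j k = p' * (1 - p') ^ (n - k) + (1 - p') * w j (k + 1)) :
    ∀ j k, 1 ≤ k → k ≤ j → j ≤ n →
      w j k = ((j - k : ℕ) : ℝ) * p' * (1 - p') ^ (n - k)
        + (1 - p') ^ (j - k) *
          ((p / p') * ((1 - p) ^ (n - j + 1) - (1 - p - p') ^ (n - j + 1))
            + (p' / p) * ((1 - p') ^ (n - j + 1) - (1 - p - p') ^ (n - j + 1))) := by
  have hp0 : p ≠ 0 := hp.ne'
  have hp0' : p' ≠ 0 := hp'.ne'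
  have diag : ∀ m j : ℕ, 1 ≤ j → j + m = n →
      w j j = (p / p') * ((1 - p) ^ (m + 1) - (1 - p - p') ^ (m + 1))
        + (p' / p) * ((1 - p') ^ (m + 1) - (1 - p - p') ^ (m + 1)) := by
    intro m
    induction m with
    | zero =>
      intro j _ hjn
      obtain rfl : j = n := hjn
      rw [hnn]
      field_simp
      ring
    | succ m ih =>
      intro j hj hjn
      rw [hdiag j hj (by omega), ih (j + 1) (by omega) (by omega),
        show n - j = m + 1 by omega]
      field_simp
      ring
  have off : ∀ d j k : ℕ, 1 ≤ k → k + d = j → j ≤ n →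
      w j k = (d : ℝ) * p' * (1 - p') ^ (n - k) + (1 - p') ^ d * w j j := by
    intro d
    induction d with
    | zero =>
      intro j k _ hkj _
      obtain rfl : k = j := hkj
      simp
    | succ d ih =>
      intro j k hk hkj hjn
      rw [hoff j k hk (by omega) hjn, ih j (k + 1) (by omega) (by omega) hjn,
        show n - k = n - (k + 1) + 1 by omega]
      push_cast
      ring
  intro j k hk hkj hjn
  rw [off (j - k) j k hk (by omega) hjn, diag (n - j) j (by omega) (by omega)]
end

section
/- For n ≥ 2, the x-strategy value function satisfies p_n(x*_n) = 2·(2 β_n − 1)^{1−n}, where β_n = 2^{1/(n−1)} and x*_n = (q − q̃ β_n) / (p (2 β_n − 1)). In particular the optimal success probability of the best x-strategy does not depend on p. -/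
/-- `β n = 2^(1/(n-1))`. -/
noncomputable def weberBeta (n : ℕ) : ℝ := (2 : ℝ) ^ ((1 : ℝ) / ((n : ℝ) - 1))

/-- Value function of the `x`-strategy in the continuous-time approximation of
Weber's problem: `pₙ(x) = 2((q + px)^n − (q̃ + 2px)^n)` with `q = 1 - p`,
`q̃ = 1 - 2p`. -/
noncomputable def weberValue (n : ℕ) (p x : ℝ) : ℝ :=
  2 * (((1 - p) + p * x) ^ n - ((1 - 2 * p) + 2 * p * x) ^ n)

/-- The critical point `x*ₙ = (q − q̃ βₙ)/(p(2βₙ − 1))`. -/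
noncomputable def weberXStar (n : ℕ) (p : ℝ) : ℝ :=
  ((1 - p) - (1 - 2 * p) * weberBeta n) / (p * (2 * weberBeta n - 1))

theorem one_lt_weberBeta {n : ℕ} (hn : 2 ≤ n) : 1 < weberBeta n := by
  have hn' : (2 : ℝ) ≤ n := by exact_mod_cast hn
  exact Real.one_lt_rpow one_lt_two (one_div_pos.mpr (by linarith))

theorem weberBeta_pow {n : ℕ} (hn : 2 ≤ n) : weberBeta n ^ n = 2 * weberBeta n := by
  obtain ⟨m, rfl⟩ : ∃ m, n = m + 1 := ⟨n - 1, by omega⟩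
  have hm : m ≠ 0 := by omega
  have hpow : weberBeta (m + 1) ^ m = 2 := by
    have hexp : (1 : ℝ) / (((m + 1 : ℕ) : ℝ) - 1) = (m : ℝ)⁻¹ := by
      push_cast
      rw [add_sub_cancel_right, one_div]
    rw [weberBeta, hexp]
    exact Real.rpow_inv_natCast_pow zero_le_two hm
  rw [pow_succ, hpow]

/-- At the critical point `x*ₙ`, the `x`-strategy value function of the
continuous-time approximation of Weber's problem equals
`2·(2βₙ − 1)^(1-n)`, where `βₙ = 2^(1/(n-1))`; in particular this value does
not depend on `p`. -/
theorem weber_value_at_xStar (n : ℕ) (hn : 2 ≤ n) (p : ℝ) (hp : 0 < p)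
    (hp2 : p < 1 / 2) :
    weberValue n p (weberXStar n p) = 2 * (2 * weberBeta n - 1) ^ ((1 : ℤ) - n) := by
  have hβ := one_lt_weberBeta hn
  have hD : 2 * weberBeta n - 1 ≠ 0 := by linarith
  have hp0 : p ≠ 0 := hp.ne'
  have hsingle : (1 - p) + p * weberXStar n p = weberBeta n / (2 * weberBeta n - 1) := by
    rw [weberXStar]
    field_simp
    ring
  have hdouble : (1 - 2 * p) + 2 * p * weberXStar n p = 1 / (2 * weberBeta n - 1) := by
    rw [weberXStar]
    field_simp
    ring
  rw [weberValue, hsingle, hdouble, div_pow, div_pow, weberBeta_pow hn, one_pow, ← sub_div,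
    zpow_sub₀ hD, zpow_one, zpow_natCast]
end

section
/- For n ≥ 2 and 0 < p < 1/2, the critical point x*_n = (q − q̃ β_n)/(p(2 β_n − 1)) satisfies x*_n ≤ 1 always, and x*_n ≥ 0 if and only if p ≥ (β_n − 1)/(2 β_n − 1). Consequently x*_n ∈ [0,1] if and only if p ≥ (β_n − 1)/(2 β_n − 1). -/
/-- For `n ≥ 2` and `0 < p < 1/2`: the critical point `x*ₙ` always satisfies
`x*ₙ ≤ 1`, and `x*ₙ ≥ 0` iff `p ≥ (βₙ − 1)/(2βₙ − 1)`; consequently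
`x*ₙ ∈ [0,1]` iff `p ≥ (βₙ − 1)/(2βₙ − 1)`. -/
theorem weber_xStar_in_unit_interval_iff (n : ℕ) (hn : 2 ≤ n) (p : ℝ)
    (hp : 0 < p) (hp2 : p < 1 / 2) :
    weberXStar n p ≤ 1 ∧
      (0 ≤ weberXStar n p ↔ (weberBeta n - 1) / (2 * weberBeta n - 1) ≤ p) ∧
      (weberXStar n p ∈ Set.Icc (0 : ℝ) 1 ↔
        (weberBeta n - 1) / (2 * weberBeta n - 1) ≤ p) := by
  have hβ : 1 < weberBeta n := one_lt_weberBeta hn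
  have hden : 0 < 2 * weberBeta n - 1 := by linarith
  have hpden : 0 < p * (2 * weberBeta n - 1) := mul_pos hp hden
  have hle : weberXStar n p ≤ 1 := by
    rw [weberXStar, div_le_one hpden]
    linarith
  have hnonneg :
      0 ≤ weberXStar n p ↔ (weberBeta n - 1) / (2 * weberBeta n - 1) ≤ p := by
    rw [weberXStar, le_div_iff₀ hpden, div_le_iff₀ hden]
    constructor <;> intro h <;> linarith
  exact ⟨hle, hnonneg, by rw [Set.mem_Icc, and_iff_left hle, hnonneg]⟩
end

section
/- The sequence a_n = 2·(2·2^{1/(n−1)} − 1)^{1−n}, defined for integers n ≥ 2, converges to 1/2 as n → ∞. -/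
/-- The derivative of `t ↦ a ^ t` at `0`, read along the sequence `1 / m`. -/
theorem tendsto_natCast_mul_rpow_one_div_sub_one {a : ℝ} (ha : 0 < a) :
    Filter.Tendsto (fun m : ℕ => (m : ℝ) * (a ^ ((1 : ℝ) / m) - 1))
      Filter.atTop (nhds (Real.log a)) := by
  have hderiv : HasDerivAt (fun t : ℝ => a ^ t) (Real.log a) 0 := by
    simpa using (Real.hasStrictDerivAt_const_rpow ha 0).hasDerivAt
  have hinv : Filter.Tendsto (fun m : ℕ => (m : ℝ)⁻¹) Filter.atTop
      (nhdsWithin 0 (Set.Ioi 0)) :=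
    tendsto_inv_atTop_nhdsGT_zero.comp tendsto_natCast_atTop_atTop
  simpa [Function.comp_def] using hderiv.tendsto_slope_zero_right.comp hinv

/-- The optimal success probability `aₙ = 2(2βₙ − 1)^(1-n)` among `x`-strategies
in the continuous-time approximation of Weber's problem, where
`βₙ = 2^(1/(n-1))`, converges to `1/2` as `n → ∞`. -/
theorem weber_optimal_value_tendsto_half :
    Filter.Tendsto
      (fun n : ℕ =>
        2 * (2 * (2 : ℝ) ^ ((1 : ℝ) / ((n : ℝ) - 1)) - 1) ^ ((1 : ℤ) - n))
      Filter.atTop (nhds (1 / 2)) := by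
  rw [← Filter.tendsto_add_atTop_iff_nat 1]
  have hmul : Filter.Tendsto
      (fun m : ℕ => (m : ℝ) * (2 * ((2 : ℝ) ^ ((1 : ℝ) / m) - 1)))
      Filter.atTop (nhds (2 * Real.log 2)) := by
    refine ((tendsto_natCast_mul_rpow_one_div_sub_one two_pos).const_mul 2).congr
      fun m => ?_
    ring
  have hexp : Real.exp (2 * Real.log 2) = 4 := by
    rw [two_mul, Real.exp_add, Real.exp_log two_pos]
    norm_num
  have hpow := Real.tendsto_one_add_pow_exp_of_tendsto hmul
  rw [hexp] at hpow
  have hlim := (hpow.inv₀ four_ne_zero).const_mul 2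
  rw [show (2 : ℝ) * 4⁻¹ = 1 / 2 by norm_num] at hlim
  refine hlim.congr fun m => ?_
  rw [show (1 : ℤ) - ((m + 1 : ℕ) : ℤ) = -(m : ℤ) by push_cast; ring,
    zpow_neg, zpow_natCast, Nat.cast_add_one, add_sub_cancel_right]
  ring
end

section
/- The sequence a_n = 2·(2·2^{1/(n−1)} − 1)^{1−n}, defined for integers n ≥ 2, is nonincreasing in n and satisfies a_n > 1/2 for every n ≥ 2. In particular, 1/2 is a lower bound for the optimal success probability in Weber's problem whenever p ≥ (β_n − 1)/(2β_n − 1), where β_n = 2^{1/(n−1)}. -/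
/-- `aₙ = 2(2βₙ − 1)^(1-n)` with `βₙ = 2^(1/(n-1))`: the optimal success
probability among `x`-strategies in the continuous-time approximation of
Weber's problem with `n` observations. -/
noncomputable def weberOptValue (n : ℕ) : ℝ :=
  2 * (2 * (2 : ℝ) ^ ((1 : ℝ) / ((n : ℝ) - 1)) - 1) ^ ((1 : ℤ) - n)

theorem weberOptValue_succ (m : ℕ) :
    weberOptValue (m + 1) = 2 * ((2 * (2 : ℝ) ^ (1 / (m : ℝ)) - 1) ^ m)⁻¹ := by
  simp [weberOptValue]

theorem one_lt_two_rpow_one_div {m : ℕ} (hm : 1 ≤ m) : (1 : ℝ) < 2 ^ (1 / (m : ℝ)) :=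
  Real.one_lt_rpow one_lt_two (by positivity)

/-- The convexity of `t ↦ t ^ ((m + 1) / m)` at the midpoint of
`1` and `2 * 2 ^ (1 / (m + 1)) - 1`. -/
theorem two_mul_two_rpow_sub_one_le {m : ℕ} (hm : 1 ≤ m) :
    2 * (2 : ℝ) ^ (1 / (m : ℝ)) - 1 ≤
      (2 * (2 : ℝ) ^ (1 / ((m + 1 : ℕ) : ℝ)) - 1) ^ (((m + 1 : ℕ) : ℝ) / m) := by
  have hm0 : (0 : ℝ) < m := by exact_mod_cast hm
  have hb := one_lt_two_rpow_one_div (m := m + 1) (by lia)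
  have hr : (1 : ℝ) ≤ ((m + 1 : ℕ) : ℝ) / m := by
    rw [one_le_div hm0]
    push_cast
    linarith
  have hpow : ((2 : ℝ) ^ (1 / ((m + 1 : ℕ) : ℝ))) ^ (((m + 1 : ℕ) : ℝ) / m) =
      2 ^ (1 / (m : ℝ)) := by
    rw [← Real.rpow_mul zero_le_two]
    congr 1
    field_simp
  have hd : 0 ≤ 2 * (2 : ℝ) ^ (1 / ((m + 1 : ℕ) : ℝ)) - 1 := by linarith
  have hmean := (convexOn_rpow hr).2 (Set.mem_Ici.2 zero_le_one) (Set.mem_Ici.2 hd)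
    one_half_pos.le one_half_pos.le (add_halves 1)
  simp only [smul_eq_mul] at hmean
  have hmid : (1 / 2 : ℝ) * 1 + 1 / 2 * (2 * (2 : ℝ) ^ (1 / ((m + 1 : ℕ) : ℝ)) - 1) =
      2 ^ (1 / ((m + 1 : ℕ) : ℝ)) := by ring
  rw [hmid, hpow, Real.one_rpow] at hmean
  linarith

theorem two_mul_two_rpow_sub_one_pow_le_succ {m : ℕ} (hm : 1 ≤ m) :
    (2 * (2 : ℝ) ^ (1 / (m : ℝ)) - 1) ^ m ≤
      (2 * (2 : ℝ) ^ (1 / ((m + 1 : ℕ) : ℝ)) - 1) ^ (m + 1) := by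
  have hm0 : (m : ℝ) ≠ 0 := by positivity
  have hb := one_lt_two_rpow_one_div hm
  have hb' := one_lt_two_rpow_one_div (m := m + 1) (by lia)
  calc (2 * (2 : ℝ) ^ (1 / (m : ℝ)) - 1) ^ m
      ≤ ((2 * (2 : ℝ) ^ (1 / ((m + 1 : ℕ) : ℝ)) - 1) ^ (((m + 1 : ℕ) : ℝ) / m)) ^ m :=
        pow_le_pow_left₀ (by linarith) (two_mul_two_rpow_sub_one_le hm) m
    _ = (2 * (2 : ℝ) ^ (1 / ((m + 1 : ℕ) : ℝ)) - 1) ^ (m + 1) := by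
        rw [← Real.rpow_mul_natCast (by linarith), div_mul_cancel₀ _ hm0, Real.rpow_natCast]

theorem two_mul_two_rpow_sub_one_pow_lt_four {m : ℕ} (hm : 1 ≤ m) :
    (2 * (2 : ℝ) ^ (1 / (m : ℝ)) - 1) ^ m < 4 := by
  have hm0 : (m : ℝ) ≠ 0 := by positivity
  have hb := one_lt_two_rpow_one_div hm
  calc (2 * (2 : ℝ) ^ (1 / (m : ℝ)) - 1) ^ m
      < (((2 : ℝ) ^ (1 / (m : ℝ))) ^ 2) ^ m :=
        pow_lt_pow_left₀ (by nlinarith) (by linarith) (by lia)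
    _ = 4 := by
        rw [pow_right_comm, ← Real.rpow_mul_natCast zero_le_two, one_div_mul_cancel hm0]
        norm_num

/-- The sequence `aₙ = 2(2·2^(1/(n-1)) − 1)^(1-n)`, `n ≥ 2`, is nonincreasing
in `n` and satisfies `aₙ > 1/2` for every `n ≥ 2`; in particular `1/2` is a
lower bound for the optimal success probability in Weber's problem whenever
`p ≥ (βₙ − 1)/(2βₙ − 1)`. -/
theorem weber_optimal_value_antitone_gt_half :
    (∀ n : ℕ, 2 ≤ n → weberOptValue (n + 1) ≤ weberOptValue n) ∧
      ∀ n : ℕ, 2 ≤ n → 1 / 2 < weberOptValue n := by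
  refine ⟨fun n hn => ?_, fun n hn => ?_⟩ <;>
    obtain ⟨m, rfl⟩ : ∃ m, n = m + 1 := ⟨n - 1, by lia⟩ <;>
    have hm : 1 ≤ m := by lia
  all_goals
    have hb := one_lt_two_rpow_one_div hm
    have hpos : 0 < (2 * (2 : ℝ) ^ (1 / (m : ℝ)) - 1) ^ m := pow_pos (by linarith) m
  · rw [weberOptValue_succ, weberOptValue_succ]
    gcongr 2 * ?_
    exact inv_anti₀ hpos (two_mul_two_rpow_sub_one_pow_le_succ hm)
  · rw [weberOptValue_succ, ← div_eq_mul_inv, lt_div_iff₀ hpos]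
    linarith [two_mul_two_rpow_sub_one_pow_lt_four hm]
end

section
/- The success probabilities of the threshold strategies satisfy the recurrences: μ(A_{n,n}) = p + p'; for 1 ≤ j < n, μ(A_{j,j}) = p'·(q')^{n−j} + p·q^{n−j} + q̃·μ(A_{j+1,j+1}); and for 1 ≤ k < j ≤ n, μ(A_{j,k}) = p'·(q')^{n−k} + q'·μ(A_{j,k+1}). -/
open MeasureTheory

/-- Distribution of a single observation in the Bruss–Weber problem:
value `1` with probability `p`, value `-1` with probability `p'`,
value `0` with probability `1 - p - p'`. -/
noncomputable def coordMeasure (p p' : ℝ) : Measure ℤ :=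
  ENNReal.ofReal p • Measure.dirac 1 + ENNReal.ofReal p' • Measure.dirac (-1)
    + ENNReal.ofReal (1 - p - p') • Measure.dirac 0

instance (p p' : ℝ) : IsFiniteMeasure (coordMeasure p p') := by
  constructor
  simp [coordMeasure]

/-- Product measure `μ` on `Ω = {1,…,n} → ℤ` (coordinates indexed by `Fin n`,
coordinate `i` representing the observation at time `i + 1`) making the
coordinates i.i.d. with distribution `coordMeasure p p'`. -/
noncomputable def bwMeasure (n : ℕ) (p p' : ℝ) : Measure (Fin n → ℤ) :=
  Measure.pi fun _ => coordMeasure p p'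

/-- The set of indices `m` (0-based; time `m + 1`) at which the threshold
strategy `τ_{j,k}` may stop: times `≥ j` with value `1`, or times `≥ k`
with value `-1`. -/
def stopSet (n j k : ℕ) (ω : Fin n → ℤ) : Finset (Fin n) :=
  Finset.univ.filter fun m => (j ≤ (m : ℕ) + 1 ∧ ω m = 1) ∨ (k ≤ (m : ℕ) + 1 ∧ ω m = -1)

/-- The stopping index `τ_{j,k}(ω)` (0-based): the least time `≥ j` with
value `1` or time `≥ k` with value `-1`; the last time `n` if no such time
exists. -/
def stopIndex (n j k : ℕ) (hn : 0 < n) (ω : Fin n → ℤ) : Fin n :=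
  (insert (⟨n - 1, by omega⟩ : Fin n) (stopSet n j k ω)).min'
    (Finset.insert_nonempty _ _)

/-- The win event `A_{j,k}`: with `t = τ_{j,k}(ω)`, one has `ω t ≠ 0` and no
later observation equals `ω t` (the strategy stops on a nonzero value that is
the last occurrence of that value). -/
def winEvent (n j k : ℕ) (hn : 0 < n) : Set (Fin n → ℤ) :=
  {ω | ω (stopIndex n j k hn ω) ≠ 0 ∧
    ∀ i : Fin n, stopIndex n j k hn ω < i → ω i ≠ ω (stopIndex n j k hn ω)}

open ProbabilityTheory

lemma coordMeasure_singleton_one (p p' : ℝ) :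
    coordMeasure p p' {1} = ENNReal.ofReal p := by
  simp [coordMeasure]

lemma coordMeasure_singleton_neg_one (p p' : ℝ) :
    coordMeasure p p' {-1} = ENNReal.ofReal p' := by
  simp [coordMeasure]

lemma coordMeasure_compl_one {p p' : ℝ} (hp' : 0 ≤ p') (hsum : p + p' ≤ 1) :
    coordMeasure p p' {1}ᶜ = ENNReal.ofReal (1 - p) := by
  have h : 1 - p = p' + (1 - p - p') := by ring
  rw [h, ENNReal.ofReal_add hp' (by linarith)]
  simp [coordMeasure]

lemma coordMeasure_compl_neg_one {p p' : ℝ} (hp : 0 ≤ p) (hsum : p + p' ≤ 1) :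
    coordMeasure p p' {-1}ᶜ = ENNReal.ofReal (1 - p') := by
  have h : 1 - p' = p + (1 - p - p') := by ring
  rw [h, ENNReal.ofReal_add hp (by linarith)]
  simp [coordMeasure]

lemma coordMeasure_compl_pair (p p' : ℝ) :
    coordMeasure p p' {1, -1}ᶜ = ENNReal.ofReal (1 - p - p') := by
  simp [coordMeasure]

lemma coordMeasure_compl_zero {p p' : ℝ} (hp : 0 ≤ p) (hp' : 0 ≤ p') :
    coordMeasure p p' {0}ᶜ = ENNReal.ofReal (p + p') := by
  rw [ENNReal.ofReal_add hp hp']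
  simp [coordMeasure]

lemma isProbabilityMeasure_coordMeasure {p p' : ℝ} (hp : 0 ≤ p) (hp' : 0 ≤ p')
    (hsum : p + p' ≤ 1) : IsProbabilityMeasure (coordMeasure p p') := by
  constructor
  have h : (1 : ℝ) = p + p' + (1 - p - p') := by ring
  rw [← ENNReal.ofReal_one, h, ENNReal.ofReal_add (by linarith) (by linarith),
    ENNReal.ofReal_add hp hp']
  simp [coordMeasure]

/-- Under a product measure, a coordinate is independent of every event that does not depend
on that coordinate. -/
lemma pi_coord_inter_of_update_iff {n : ℕ} (ν : Measure ℤ) [IsProbabilityMeasure ν] (c : Fin n)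
    (S : Set ℤ) (B : Set (Fin n → ℤ))
    (hB : ∀ ω x, Function.update ω c x ∈ B ↔ ω ∈ B) :
    Measure.pi (fun _ : Fin n => ν) ({ω | ω c ∈ S} ∩ B)
      = ν S * Measure.pi (fun _ : Fin n => ν) B := by
  set μ := Measure.pi (fun _ : Fin n => ν)
  have hind : iIndepFun (fun (i : Fin n) (ω : Fin n → ℤ) => ω i) μ :=
    iIndepFun_pi (X := fun _ x => x) fun _ => aemeasurable_id
  have hfin := hind.indepFun_finset {c} {c}ᶜ disjoint_compl_right fun i => measurable_pi_apply i
  let r : (Fin n → ℤ) → ({c}ᶜ : Finset (Fin n)) → ℤ := fun ω i => ω i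
  have hr : r ⁻¹' (r '' B) = B := by
    refine Set.Subset.antisymm ?_ (Set.subset_preimage_image r B)
    rintro ω ⟨ω', hω', h⟩
    have : Function.update ω' c (ω c) = ω := by
      ext i
      by_cases hi : i = c
      · subst hi; simp
      · simpa [hi] using congrFun h ⟨i, by simpa using hi⟩
    rw [← this]
    exact (hB ω' _).2 hω'
  have key := hfin.measure_inter_preimage_eq_mul
    {f | f ⟨c, by simp⟩ ∈ S} (r '' B) (Set.to_countable _).measurableSet
    (Set.to_countable _).measurableSet
  have hS : μ {ω | ω c ∈ S} = ν S :=
    (measurePreserving_eval (fun _ : Fin n => ν) c).measure_preimage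
      (Set.to_countable S).measurableSet.nullMeasurableSet
  change μ ({ω | ω c ∈ S} ∩ r ⁻¹' (r '' B)) = μ {ω | ω c ∈ S} * μ (r ⁻¹' (r '' B)) at key
  rwa [hr, hS] at key

/-- The probability that every coordinate after `c` avoids the value `a`. -/
lemma pi_forall_gt_ne {n : ℕ} (ν : Measure ℤ) [IsProbabilityMeasure ν] (c : Fin n) (a : ℤ) :
    Measure.pi (fun _ : Fin n => ν) {ω | ∀ i, c < i → ω i ≠ a}
      = ν {a}ᶜ ^ (n - (c + 1)) := by
  have h : {ω : Fin n → ℤ | ∀ i, c < i → ω i ≠ a}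
      = Set.univ.pi fun i => if c < i then {a}ᶜ else Set.univ := by
    ext ω
    simp only [Set.mem_ofPred_eq, Set.mem_univ_pi]
    refine forall_congr' fun i => ?_
    split_ifs with hi <;> simp [hi]
  have hcard : (Finset.univ.filter fun i => c < i).card = n - (c + 1) := by
    rw [Finset.filter_lt_eq_Ioi, Fin.card_Ioi]
    omega
  rw [h, Measure.pi_pi]
  simp only [apply_ite ν, measure_univ]
  rw [Finset.prod_ite]
  simp [hcard]

/-- The probability that coordinate `c` is the last occurrence of the value `a`. -/
lemma pi_last_occurrence {n : ℕ} (ν : Measure ℤ) [IsProbabilityMeasure ν] (c : Fin n) (a : ℤ) :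
    Measure.pi (fun _ : Fin n => ν) ({ω | ω c ∈ ({a} : Set ℤ)} ∩ {ω | ∀ i, c < i → ω i ≠ a})
      = ν {a} * ν {a}ᶜ ^ (n - (c + 1)) := by
  rw [pi_coord_inter_of_update_iff ν c {a}, pi_forall_gt_ne]
  intro ω x
  refine forall_congr' fun i => forall_congr' fun hi => ?_
  rw [Function.update_of_ne hi.ne']

lemma le_stopIndex {n j k : ℕ} (hn : 0 < n) (ω : Fin n → ℤ) (c : Fin n)
    (hj : (c : ℕ) + 1 ≤ j) (hk : (c : ℕ) + 1 ≤ k) : c ≤ stopIndex n j k hn ω := by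
  refine Finset.le_min' _ _ _ fun m hm => ?_
  simp only [stopSet, Finset.mem_insert, Finset.mem_filter, Finset.mem_univ, true_and] at hm
  rw [Fin.le_def]
  rcases hm with rfl | h | h
  · have := c.isLt
    simp only
    omega
  · omega
  · omega

lemma stopIndex_eq_of_mem {n j k : ℕ} (hn : 0 < n) (ω : Fin n → ℤ) (c : Fin n)
    (hj : (c : ℕ) + 1 ≤ j) (hk : (c : ℕ) + 1 ≤ k) (hc : c ∈ stopSet n j k ω) :
    stopIndex n j k hn ω = c :=
  le_antisymm (Finset.min'_le _ _ (Finset.mem_insert_of_mem hc)) (le_stopIndex hn ω c hj hk)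

lemma mem_winEvent_congr {n j k j' k' : ℕ} (hn : 0 < n) {ω : Fin n → ℤ}
    (h : stopSet n j k ω = stopSet n j' k' ω) :
    ω ∈ winEvent n j k hn ↔ ω ∈ winEvent n j' k' hn := by
  have : stopIndex n j k hn ω = stopIndex n j' k' hn ω := by simp only [stopIndex, h]
  simp only [winEvent, Set.mem_ofPred_eq, this]

lemma mem_winEvent_iff_of_mem_stopSet {n j k : ℕ} (hn : 0 < n) {ω : Fin n → ℤ} {c : Fin n}
    (hj : (c : ℕ) + 1 ≤ j) (hk : (c : ℕ) + 1 ≤ k) (hc : c ∈ stopSet n j k ω) :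
    ω ∈ winEvent n j k hn ↔ ∀ i, c < i → ω i ≠ ω c := by
  have h0 : ω c ≠ 0 := by
    simp only [stopSet, Finset.mem_filter] at hc
    rcases hc.2 with h | h <;> simp [h.2]
  simp [winEvent, stopIndex_eq_of_mem hn ω c hj hk hc, h0]

/-- The win event does not depend on the coordinates before both thresholds. -/
lemma update_mem_winEvent_iff {n j k : ℕ} (hn : 0 < n) (c : Fin n) (hcn : (c : ℕ) + 1 < n)
    (hj : (c : ℕ) + 1 < j) (hk : (c : ℕ) + 1 < k) (ω : Fin n → ℤ) (x : ℤ) :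
    Function.update ω c x ∈ winEvent n j k hn ↔ ω ∈ winEvent n j k hn := by
  have hset : stopSet n j k (Function.update ω c x) = stopSet n j k ω := by
    ext m
    by_cases hm : m = c
    · subst hm
      simp [stopSet, hj.not_ge, hk.not_ge]
    · simp [stopSet, hm]
  have hidx : stopIndex n j k hn (Function.update ω c x) = stopIndex n j k hn ω := by
    simp only [stopIndex, hset]
  have hlt : c < stopIndex n j k hn ω :=
    lt_of_lt_of_le (Fin.lt_def.2 (Nat.lt_succ_self _))
      (le_stopIndex hn ω ⟨c + 1, hcn⟩ hj hk)
  simp only [winEvent, Set.mem_ofPred_eq, hidx, Function.update_of_ne hlt.ne']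
  refine and_congr_right fun _ => forall_congr' fun i => forall_congr' fun hi => ?_
  rw [Function.update_of_ne (hlt.trans hi).ne']

lemma winEvent_self {n : ℕ} (hn : 0 < n) :
    winEvent n n n hn = {ω | ω ⟨n - 1, by omega⟩ ∈ ({0}ᶜ : Set ℤ)} := by
  ext ω
  have hidx : stopIndex n n n hn ω = ⟨n - 1, by omega⟩ :=
    le_antisymm (Finset.min'_le _ _ (Finset.mem_insert_self _ _))
      (le_stopIndex hn ω _ (by simp only; omega) (by simp only; omega))
  simp only [winEvent, Set.mem_ofPred_eq, hidx, Set.mem_compl_iff, Set.mem_singleton_iff,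
    and_iff_left_iff_imp]
  intro _ i hi
  have := i.isLt
  rw [Fin.lt_def] at hi
  simp only at hi
  omega

/-- Splitting the win event for equal thresholds according to the coordinate at the threshold. -/
lemma winEvent_diag_eq {n : ℕ} (hn : 0 < n) (c : Fin n) :
    winEvent n (c + 1) (c + 1) hn =
      (({ω | ω c ∈ ({-1} : Set ℤ)} ∩ {ω | ∀ i, c < i → ω i ≠ -1}) ∪
        ({ω | ω c ∈ ({1} : Set ℤ)} ∩ {ω | ∀ i, c < i → ω i ≠ 1})) ∪
      ({ω | ω c ∈ ({1, -1}ᶜ : Set ℤ)} ∩ winEvent n (c + 1 + 1) (c + 1 + 1) hn) := by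
  ext ω
  by_cases h1 : ω c = 1
  · rw [mem_winEvent_iff_of_mem_stopSet hn le_rfl le_rfl (by simp [stopSet, h1])]
    simp [h1]
  by_cases h2 : ω c = -1
  · rw [mem_winEvent_iff_of_mem_stopSet hn le_rfl le_rfl (by simp [stopSet, h2])]
    simp [h2]
  · rw [mem_winEvent_congr hn (j' := c + 1 + 1) (k' := c + 1 + 1)]
    · simp [h1, h2]
    · ext m
      by_cases hm : m = c
      · simp [stopSet, hm, h1, h2]
      · have : (c : ℕ) + 1 ≤ m + 1 ↔ (c : ℕ) + 1 + 1 ≤ m + 1 := by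
          have := Fin.val_ne_of_ne hm
          omega
        simp only [stopSet, Finset.mem_filter, this]

/-- Splitting the win event for distinct thresholds according to the coordinate at the lower
threshold. -/
lemma winEvent_offDiag_eq {n j : ℕ} (hn : 0 < n) (c : Fin n) (hj : (c : ℕ) + 1 < j) :
    winEvent n j (c + 1) hn =
      ({ω | ω c ∈ ({-1} : Set ℤ)} ∩ {ω | ∀ i, c < i → ω i ≠ -1}) ∪
      ({ω | ω c ∈ ({-1}ᶜ : Set ℤ)} ∩ winEvent n j (c + 1 + 1) hn) := by
  ext ω
  by_cases h2 : ω c = -1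
  · rw [mem_winEvent_iff_of_mem_stopSet hn hj.le le_rfl (by simp [stopSet, h2])]
    simp [h2]
  · rw [mem_winEvent_congr hn (j' := j) (k' := c + 1 + 1)]
    · simp [h2]
    · ext m
      by_cases hm : m = c
      · simp [stopSet, hm, h2]
      · have : (c : ℕ) + 1 ≤ m + 1 ↔ (c : ℕ) + 1 + 1 ≤ m + 1 := by
          have := Fin.val_ne_of_ne hm
          omega
        simp only [stopSet, Finset.mem_filter, this]

/-- Recurrences for the success probabilities `μ(A_{j,k})` of the threshold
strategies in the Bruss–Weber problem (`q = 1 - p`, `q' = 1 - p'`,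
`q̃ = 1 - p - p'`):
`μ(A_{n,n}) = p + p'`;
`μ(A_{j,j}) = p'·(q')^(n-j) + p·q^(n-j) + q̃·μ(A_{j+1,j+1})` for `1 ≤ j < n`;
`μ(A_{j,k}) = p'·(q')^(n-k) + q'·μ(A_{j,k+1})` for `1 ≤ k < j ≤ n`. -/
theorem bruss_weber_win_probability_recurrences
    (n : ℕ) (hn : 0 < n) (p p' : ℝ) (hp : 0 < p) (hp' : 0 < p')
    (hsum : p + p' < 1) :
    bwMeasure n p p' (winEvent n n n hn) = ENNReal.ofReal (p + p') ∧
      (∀ j, 1 ≤ j → j < n →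
        bwMeasure n p p' (winEvent n j j hn) =
          ENNReal.ofReal (p' * (1 - p') ^ (n - j) + p * (1 - p) ^ (n - j))
            + ENNReal.ofReal (1 - p - p') *
              bwMeasure n p p' (winEvent n (j + 1) (j + 1) hn)) ∧
      ∀ j k, 1 ≤ k → k < j → j ≤ n →
        bwMeasure n p p' (winEvent n j k hn) =
          ENNReal.ofReal (p' * (1 - p') ^ (n - k))
            + ENNReal.ofReal (1 - p') *
              bwMeasure n p p' (winEvent n j (k + 1) hn) := by
  have := isProbabilityMeasure_coordMeasure hp.le hp'.le hsum.le
  have hq : 0 ≤ 1 - p := by linarith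
  have hq' : 0 ≤ 1 - p' := by linarith
  refine ⟨?_, fun j hj1 hjn => ?_, fun j k hk1 hkj hjn => ?_⟩
  · rw [winEvent_self, ← coordMeasure_compl_zero hp.le hp'.le]
    exact (measurePreserving_eval (fun _ : Fin n => coordMeasure p p') _).measure_preimage
      (Set.to_countable _).measurableSet.nullMeasurableSet
  · obtain ⟨c, rfl⟩ : ∃ c : Fin n, (c : ℕ) + 1 = j := ⟨⟨j - 1, by omega⟩, by simp only; omega⟩
    rw [winEvent_diag_eq, bwMeasure,
      measure_union _ (Set.to_countable _).measurableSet,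
      measure_union _ (Set.to_countable _).measurableSet,
      pi_last_occurrence, pi_last_occurrence,
      pi_coord_inter_of_update_iff _ c _ _
        (update_mem_winEvent_iff hn c hjn (Nat.lt_succ_self _) (Nat.lt_succ_self _)),
      coordMeasure_singleton_neg_one, coordMeasure_singleton_one, coordMeasure_compl_pair,
      coordMeasure_compl_one hp'.le hsum.le, coordMeasure_compl_neg_one hp.le hsum.le,
      ENNReal.ofReal_add (by positivity) (by positivity), ENNReal.ofReal_mul hp.le,
      ENNReal.ofReal_mul hp'.le, ENNReal.ofReal_pow hq, ENNReal.ofReal_pow hq']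
    all_goals
      rw [Set.disjoint_left]
      simp +contextual
    rintro ω (h | h) <;> simp [h]
  · obtain ⟨c, rfl⟩ : ∃ c : Fin n, (c : ℕ) + 1 = k := ⟨⟨k - 1, by omega⟩, by simp only; omega⟩
    rw [winEvent_offDiag_eq hn c hkj, bwMeasure,
      measure_union _ (Set.to_countable _).measurableSet,
      pi_last_occurrence,
      pi_coord_inter_of_update_iff _ c _ _
        (update_mem_winEvent_iff hn c (hkj.trans_le hjn) hkj (Nat.lt_succ_self _)),
      coordMeasure_singleton_neg_one, coordMeasure_compl_neg_one hp.le hsum.le,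
      ENNReal.ofReal_mul hp'.le, ENNReal.ofReal_pow hq']
    rw [Set.disjoint_left]
    simp +contextual
end

section
/- For every k with 0 ≤ k ≤ n−2, if V_k > v_k then V_{k+1} > v_{k+1}; that is, the time-inhomogeneous symmetric Bruss–Weber problem is monotone: if it is strictly optimal to stop on a nonzero observation at stage k+1, it remains strictly optimal at every later stage. -/
/-- The time-inhomogeneous symmetric Bruss–Weber problem is monotone.
With `V k = ∏_{j=k+1}^n (1 - p j)` and optimal continuation values `v`
defined backwards by `v n = 0` and
`v k = 2 p_(k+1)·max(v_(k+1), V_(k+1)) + (1 - 2 p_(k+1))·v_(k+1)`,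
if `V k > v k` then `V (k+1) > v (k+1)` (for `0 ≤ k ≤ n-2`):
if it is strictly optimal to stop on a nonzero observation at stage `k+1`,
it remains strictly optimal at every later stage. -/
theorem bruss_weber_inhomogeneous_monotone
    (n : ℕ) (hn : 1 ≤ n) (p : ℕ → ℝ) (hp : ∀ j, 0 < p j ∧ p j ≤ 1 / 2)
    (V : ℕ → ℝ) (hV : ∀ k, V k = ∏ j ∈ Finset.Icc (k + 1) n, (1 - p j))
    (v : ℕ → ℝ) (hvn : v n = 0)
    (hv : ∀ k, k < n → v k =
      2 * p (k + 1) * max (v (k + 1)) (V (k + 1))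
        + (1 - 2 * p (k + 1)) * v (k + 1)) :
    ∀ k, k + 2 ≤ n → V k > v k → V (k + 1) > v (k + 1) := by
  intro k hk hlt
  by_contra! hle
  have hrec := hv k (by omega)
  rw [max_eq_left hle] at hrec
  have hpos : 0 ≤ V (k + 1) := by
    rw [hV]
    exact Finset.prod_nonneg fun j _ => by linarith [(hp j).2]
  have hstep : V k = (1 - p (k + 1)) * V (k + 1) := by
    rw [hV k, hV (k + 1), ← Finset.insert_Icc_add_one_left_eq_Icc (by omega : k + 1 ≤ n),
      Finset.prod_insert (by simp)]
  nlinarith [mul_nonneg (hp (k + 1)).1.le hpos]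
end
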